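/- Let X_1,…,X_{K+1} be mutually independent finitely-valued random variables and let (X_1,…,X_{K+1},Y,Z) be jointly distributed, with 𝒦 = {1,…,K}. Let S, S₁ ⊆ 𝒦 be nonempty, S′ ⊆ S be nonempty, and S₁′ ⊆ S₁. Then [ I(X_{S∩S₁};Y|X_{(𝒦∖(S∩S₁))∪{K+1}}) − I(X_{S′∩S₁′};Z) ] + [ I(X_{(S∪S₁)∪{K+1}};Y|X_{𝒦∖(S∪S₁)}) − I(X_{(S′∪S₁′)∪{K+1}};Z) ] ≤ [ I(X_S;Y|X_{(𝒦∖S)∪{K+1}}) − I(X_{S′∪{K+1}};Z) ] + [ I(X_{S₁∪{K+1}};Y|X_{𝒦∖S₁}) − I(X_{S₁′};Z) ]. -/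

import Mathlib

open scoped Classical

noncomputable section

/-- Probability that random variable `X` takes value `x`, under pmf `p` on a finite sample space. -/
def probOf {Ω α : Type} [Fintype Ω] (p : Ω → ℝ) (X : Ω → α) (x : α) : ℝ :=
  ∑ ω, if X ω = x then p ω else 0

/-- Shannon entropy of a finitely-valued random variable. -/
def Hent {Ω α : Type} [Fintype Ω] [Fintype α] (p : Ω → ℝ) (X : Ω → α) : ℝ :=
  -∑ x, probOf p X x * Real.log (probOf p X x)

/-- Conditional entropy `H(X | C)`. -/
def condHent {Ω α γ : Type} [Fintype Ω] [Fintype α] [Fintype γ]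
    (p : Ω → ℝ) (X : Ω → α) (C : Ω → γ) : ℝ :=
  Hent p (fun ω => (X ω, C ω)) - Hent p C

/-- Conditional mutual information `I(A;B | C)`. -/
def IcondMut {Ω α β γ : Type} [Fintype Ω] [Fintype α] [Fintype β] [Fintype γ]
    (p : Ω → ℝ) (A : Ω → α) (B : Ω → β) (C : Ω → γ) : ℝ :=
  condHent p A C + condHent p B C - condHent p (fun ω => (A ω, B ω)) C

/-- Mutual information `I(A;B)`. -/
def Imut {Ω α β : Type} [Fintype Ω] [Fintype α] [Fintype β]
    (p : Ω → ℝ) (A : Ω → α) (B : Ω → β) : ℝ :=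
  Hent p A + Hent p B - Hent p (fun ω => (A ω, B ω))

/-- `p` is a probability mass function. -/
def IsPMF {Ω : Type} [Fintype Ω] (p : Ω → ℝ) : Prop :=
  (∀ ω, 0 ≤ p ω) ∧ ∑ ω, p ω = 1

/-- The tuple `X_S = (X_k)_{k ∈ S}` as a random variable. -/
def tup {Ω ι : Type} {𝒳 : ι → Type} (X : ∀ k, Ω → 𝒳 k) (S : Finset ι) :
    Ω → ∀ k : S, 𝒳 k.1 :=
  fun ω k => X k.1 ω

/-- The random variables `X_1, …, X_K` are mutually independent. -/
def MutIndep {Ω ι : Type} [Fintype Ω] [Fintype ι] {𝒳 : ι → Type} [∀ k, Fintype (𝒳 k)]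
    (p : Ω → ℝ) (X : ∀ k, Ω → 𝒳 k) : Prop :=
  ∀ x : ∀ k, 𝒳 k, probOf p (fun ω k => X k ω) x = ∏ k, probOf p (X k) (x k)

section Entropy

variable {Ω α β γ : Type} [Fintype Ω]

lemma sum_probOf_mul [Fintype α] (p : Ω → ℝ) (X : Ω → α) (g : α → ℝ) :
    ∑ x, probOf p X x * g x = ∑ ω, p ω * g (X ω) := by
  simp only [probOf, Finset.sum_mul]
  rw [Finset.sum_comm]
  simp [ite_mul]

/-- Entropy is the expected surprisal. -/
lemma Hent_eq_neg_sum [Fintype α] (p : Ω → ℝ) (X : Ω → α) :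
    Hent p X = -∑ ω, p ω * Real.log (probOf p X (X ω)) := by
  rw [Hent, sum_probOf_mul p X fun x => Real.log (probOf p X x)]

/-- Random variables inducing the same partition of the sample space have the same entropy. -/
lemma Hent_congr [Fintype α] [Fintype β] (p : Ω → ℝ) {X : Ω → α} {Y : Ω → β}
    (h : ∀ ω ω', X ω = X ω' ↔ Y ω = Y ω') : Hent p X = Hent p Y := by
  simp only [Hent_eq_neg_sum, probOf, h]

lemma probOf_nonneg {p : Ω → ℝ} (hp : IsPMF p) (X : Ω → α) (x : α) : 0 ≤ probOf p X x :=
  Finset.sum_nonneg fun ω _ => by split_ifs <;> simp [hp.1 ω]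

lemma le_probOf_self {p : Ω → ℝ} (hp : IsPMF p) (X : Ω → α) (ω : Ω) :
    p ω ≤ probOf p X (X ω) := by
  have := Finset.single_le_sum (f := fun ω' => if X ω' = X ω then p ω' else 0)
    (fun ω' _ => by split_ifs <;> simp [hp.1 ω']) (Finset.mem_univ ω)
  simpa [probOf] using this

lemma sum_probOf_prodMk [Fintype α] (p : Ω → ℝ) (A : Ω → α) (C : Ω → γ) (c : γ) :
    ∑ a, probOf p (fun ω => (A ω, C ω)) (a, c) = probOf p C c := by
  simp only [probOf]
  rw [Finset.sum_comm]
  refine Finset.sum_congr rfl fun ω _ => ?_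
  by_cases h : C ω = c <;> simp [h]

lemma sum_probOf [Fintype α] {p : Ω → ℝ} (hp : IsPMF p) (X : Ω → α) :
    ∑ x, probOf p X x = 1 := by
  simpa [hp.2] using sum_probOf_mul p X fun _ => 1

/-- The expected likelihood ratio between the conditionally independent coupling of `A` and `B`
given `C` and the actual joint law is at most one. -/
lemma sum_mul_condIndep_ratio_le_one [Fintype α] [Fintype β] [Fintype γ] {p : Ω → ℝ}
    (hp : IsPMF p) (A : Ω → α) (B : Ω → β) (C : Ω → γ) :
    ∑ ω, p ω * (probOf p (fun ω => (A ω, C ω)) (A ω, C ω) *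
      probOf p (fun ω => (B ω, C ω)) (B ω, C ω) /
      (probOf p (fun ω => (A ω, B ω, C ω)) (A ω, B ω, C ω) * probOf p C (C ω))) ≤ 1 := by
  rw [← sum_probOf_mul p (fun ω => (A ω, B ω, C ω)) fun x =>
    probOf p (fun ω => (A ω, C ω)) (x.1, x.2.2) * probOf p (fun ω => (B ω, C ω)) x.2 /
      (probOf p (fun ω => (A ω, B ω, C ω)) x * probOf p C x.2.2)]
  calc
    _ ≤ ∑ x : α × β × γ, probOf p (fun ω => (A ω, C ω)) (x.1, x.2.2) *
          probOf p (fun ω => (B ω, C ω)) x.2 / probOf p C x.2.2 := by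
        refine Finset.sum_le_sum fun x _ => ?_
        have hA := probOf_nonneg hp (fun ω => (A ω, C ω)) (x.1, x.2.2)
        have hB := probOf_nonneg hp (fun ω => (B ω, C ω)) x.2
        have hC := probOf_nonneg hp C x.2.2
        rcases eq_or_ne (probOf p (fun ω => (A ω, B ω, C ω)) x) 0 with h | h
        · rw [h, zero_mul]
          positivity
        · rw [← mul_div_assoc, mul_div_mul_left _ _ h]
    _ = ∑ c, probOf p C c * probOf p C c / probOf p C c := by
        simp only [Fintype.sum_prod_type]
        conv_lhs => enter [2, a]; rw [Finset.sum_comm]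
        rw [Finset.sum_comm]
        refine Finset.sum_congr rfl fun c _ => ?_
        simp only [← Finset.sum_div, ← Finset.mul_sum, ← Finset.sum_mul, sum_probOf_prodMk]
    _ = 1 := by
        simp only [mul_self_div_self, sum_probOf hp]

/-- Conditional mutual information is nonnegative, in terms of joint entropies. -/
lemma Hent_add_Hent_le [Fintype α] [Fintype β] [Fintype γ] {p : Ω → ℝ} (hp : IsPMF p)
    (A : Ω → α) (B : Ω → β) (C : Ω → γ) :
    Hent p (fun ω => (A ω, B ω, C ω)) + Hent p C ≤
      Hent p (fun ω => (A ω, C ω)) + Hent p (fun ω => (B ω, C ω)) := by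
  have hratio := sum_mul_condIndep_ratio_le_one hp A B C
  have hlog : ∀ ω, p ω * (Real.log (probOf p (fun ω => (A ω, C ω)) (A ω, C ω)) +
      Real.log (probOf p (fun ω => (B ω, C ω)) (B ω, C ω)) -
      (Real.log (probOf p (fun ω => (A ω, B ω, C ω)) (A ω, B ω, C ω)) +
        Real.log (probOf p C (C ω)))) ≤
      p ω * (probOf p (fun ω => (A ω, C ω)) (A ω, C ω) *
      probOf p (fun ω => (B ω, C ω)) (B ω, C ω) /
      (probOf p (fun ω => (A ω, B ω, C ω)) (A ω, B ω, C ω) * probOf p C (C ω))) - p ω := by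
    intro ω
    rcases (hp.1 ω).eq_or_lt with h | h
    · simp [← h]
    have h1 := h.trans_le (le_probOf_self hp (fun ω => (A ω, C ω)) ω)
    have h2 := h.trans_le (le_probOf_self hp (fun ω => (B ω, C ω)) ω)
    have h3 := h.trans_le (le_probOf_self hp (fun ω => (A ω, B ω, C ω)) ω)
    have h4 := h.trans_le (le_probOf_self hp C ω)
    rw [← Real.log_mul h1.ne' h2.ne', ← Real.log_mul h3.ne' h4.ne',
      ← Real.log_div (by positivity) (by positivity)]
    have := mul_le_mul_of_nonneg_left
      (Real.log_le_sub_one_of_pos (div_pos (mul_pos h1 h2) (mul_pos h3 h4))) h.le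
    linarith
  have hsum := Finset.sum_le_sum fun ω (_ : ω ∈ Finset.univ) => hlog ω
  simp only [mul_sub, mul_add, Finset.sum_sub_distrib, Finset.sum_add_distrib, hp.2] at hsum
  simp only [Hent_eq_neg_sum]
  linarith

end Entropy

section Tuples

lemma tup_eq_iff {Ω ι : Type} {𝒳 : ι → Type} (X : ∀ k, Ω → 𝒳 k) (S : Finset ι) (ω ω' : Ω) :
    tup X S ω = tup X S ω' ↔ ∀ k ∈ S, X k ω = X k ω' := by
  simp [tup, funext_iff]

variable {Ω ι : Type} [Fintype Ω] [DecidableEq ι] {𝒳 : ι → Type} [∀ k, Fintype (𝒳 k)]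

/-- The joint entropy of `X_S` and `W` is submodular in `S`. -/
lemma Hent_tup_prodMk_submodular {β : Type} [Fintype β] {p : Ω → ℝ} (hp : IsPMF p)
    (X : ∀ k, Ω → 𝒳 k) (W : Ω → β) (S T : Finset ι) :
    Hent p (fun ω => (tup X (S ∪ T) ω, W ω)) + Hent p (fun ω => (tup X (S ∩ T) ω, W ω)) ≤
      Hent p (fun ω => (tup X S ω, W ω)) + Hent p (fun ω => (tup X T ω, W ω)) := by
  have h := Hent_add_Hent_le hp (tup X S) (tup X T) fun ω => (tup X (S ∩ T) ω, W ω)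
  have h1 : Hent p (fun ω => (tup X S ω, tup X T ω, tup X (S ∩ T) ω, W ω)) =
      Hent p (fun ω => (tup X (S ∪ T) ω, W ω)) :=
    Hent_congr p fun ω ω' => by
      simp only [Prod.mk.injEq, tup_eq_iff, Finset.mem_union, Finset.mem_inter]; grind
  have h2 : Hent p (fun ω => (tup X S ω, tup X (S ∩ T) ω, W ω)) =
      Hent p (fun ω => (tup X S ω, W ω)) :=
    Hent_congr p fun ω ω' => by
      simp only [Prod.mk.injEq, tup_eq_iff, Finset.mem_inter]; grind
  have h3 : Hent p (fun ω => (tup X T ω, tup X (S ∩ T) ω, W ω)) =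
      Hent p (fun ω => (tup X T ω, W ω)) :=
    Hent_congr p fun ω ω' => by
      simp only [Prod.mk.injEq, tup_eq_iff, Finset.mem_inter]; grind
  linarith

lemma Hent_tup_submodular {p : Ω → ℝ} (hp : IsPMF p)
    (X : ∀ k, Ω → 𝒳 k) (S T : Finset ι) :
    Hent p (tup X (S ∪ T)) + Hent p (tup X (S ∩ T)) ≤ Hent p (tup X S) + Hent p (tup X T) := by
  have h := Hent_tup_prodMk_submodular hp X (fun _ => ()) S T
  have hunit : ∀ R, Hent p (fun ω => (tup X R ω, ())) = Hent p (tup X R) := fun R =>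
    Hent_congr p fun ω ω' => by simp
  simpa only [hunit] using h

lemma Hent_tup_empty {p : Ω → ℝ} (hp : IsPMF p) (X : ∀ k, Ω → 𝒳 k) :
    Hent p (tup X ∅) = 0 := by
  have h : ∀ ω ω', tup X ∅ ω = tup X ∅ ω' := fun ω ω' => by simp [tup_eq_iff]
  simp only [Hent_eq_neg_sum, probOf, if_pos (h _ _)]
  simp [hp.2]

lemma Hent_tup_le_sum {p : Ω → ℝ} (hp : IsPMF p) (X : ∀ k, Ω → 𝒳 k) (S : Finset ι) :
    Hent p (tup X S) ≤ ∑ k ∈ S, Hent p (X k) := by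
  induction S using Finset.induction_on with
  | empty => simp [Hent_tup_empty hp]
  | insert a S ha ih =>
    have h := Hent_tup_submodular hp X {a} S
    have hsingle : Hent p (tup X {a}) = Hent p (X a) :=
      Hent_congr p fun ω ω' => by simp [tup_eq_iff]
    rw [Finset.singleton_inter_of_notMem ha, Hent_tup_empty hp, hsingle,
      ← Finset.insert_eq] at h
    rw [Finset.sum_insert ha]
    linarith

lemma MutIndep.Hent_pi [Fintype ι] {p : Ω → ℝ} (hp : IsPMF p) {X : ∀ k, Ω → 𝒳 k}
    (hind : MutIndep p X) : Hent p (fun ω k => X k ω) = ∑ k, Hent p (X k) := by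
  simp only [Hent_eq_neg_sum, hind _, Finset.sum_neg_distrib]
  rw [Finset.sum_comm]
  congr 1
  refine Finset.sum_congr rfl fun ω _ => ?_
  rw [← Finset.mul_sum]
  rcases (hp.1 ω).eq_or_lt with h | h
  · simp [← h]
  · rw [Real.log_prod fun k _ => (h.trans_le (le_probOf_self hp (X k) ω)).ne']

/-- Entropy is additive over every subfamily of a mutually independent family. -/
lemma MutIndep.Hent_tup [Fintype ι] {p : Ω → ℝ} (hp : IsPMF p) {X : ∀ k, Ω → 𝒳 k}
    (hind : MutIndep p X) (S : Finset ι) : Hent p (tup X S) = ∑ k ∈ S, Hent p (X k) := by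
  have huniv : Hent p (tup X (S ∪ Sᶜ)) = ∑ k, Hent p (X k) := by
    rw [← hind.Hent_pi hp]
    exact Hent_congr p fun ω ω' => by rw [tup_eq_iff, funext_iff]; simp
  have hsub := Hent_tup_submodular hp X S Sᶜ
  rw [Finset.inter_compl, Hent_tup_empty hp, huniv, ← Finset.sum_add_sum_compl S] at hsub
  linarith [Hent_tup_le_sum hp X S, Hent_tup_le_sum hp X Sᶜ]

lemma MutIndep.Hent_tup_modular [Fintype ι] {p : Ω → ℝ} (hp : IsPMF p)
    {X : ∀ k, Ω → 𝒳 k} (hind : MutIndep p X) (S T : Finset ι) :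
    Hent p (tup X (S ∪ T)) + Hent p (tup X (S ∩ T)) = Hent p (tup X S) + Hent p (tup X T) := by
  simp only [hind.Hent_tup hp, Finset.sum_union_inter]

/-- For independent `X_k`, the information `I(X_S;Z)` is supermodular in `S`. -/
lemma MutIndep.Imut_tup_supermodular [Fintype ι] {β : Type} [Fintype β] {p : Ω → ℝ}
    (hp : IsPMF p) {X : ∀ k, Ω → 𝒳 k} (hind : MutIndep p X) (Z : Ω → β) (S T : Finset ι) :
    Imut p (tup X S) Z + Imut p (tup X T) Z ≤
      Imut p (tup X (S ∪ T)) Z + Imut p (tup X (S ∩ T)) Z := by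
  have h := Hent_tup_prodMk_submodular hp X Z S T
  have hm := hind.Hent_tup_modular hp S T
  simp only [Imut]
  linarith

lemma IcondMut_tup_compl [Fintype ι] {β : Type} [Fintype β] (p : Ω → ℝ)
    (X : ∀ k, Ω → 𝒳 k) (Y : Ω → β) (S : Finset ι) :
    IcondMut p (tup X S) Y (tup X Sᶜ) =
      Hent p (tup X Finset.univ) - Hent p (fun ω => (tup X Finset.univ ω, Y ω)) +
        Hent p (fun ω => (tup X Sᶜ ω, Y ω)) - Hent p (tup X Sᶜ) := by
  have h1 : Hent p (fun ω => (tup X S ω, tup X Sᶜ ω)) = Hent p (tup X Finset.univ) :=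
    Hent_congr p fun ω ω' => by
      simp only [Prod.mk.injEq, tup_eq_iff, Finset.mem_compl, Finset.mem_univ]; grind
  have h2 : Hent p (fun ω => (Y ω, tup X Sᶜ ω)) = Hent p (fun ω => (tup X Sᶜ ω, Y ω)) :=
    Hent_congr p fun ω ω' => by simp only [Prod.mk.injEq, and_comm]
  have h3 : Hent p (fun ω => ((tup X S ω, Y ω), tup X Sᶜ ω)) =
      Hent p (fun ω => (tup X Finset.univ ω, Y ω)) :=
    Hent_congr p fun ω ω' => by
      simp only [Prod.mk.injEq, tup_eq_iff, Finset.mem_compl, Finset.mem_univ]; grind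
  simp only [IcondMut, condHent, h1, h2, h3]
  ring

/-- For independent `X_k`, the information `I(X_S;Y|X_{Sᶜ})` is submodular in `S`. -/
lemma MutIndep.IcondMut_tup_submodular [Fintype ι] {β : Type} [Fintype β]
    {p : Ω → ℝ} (hp : IsPMF p) {X : ∀ k, Ω → 𝒳 k} (hind : MutIndep p X) (Y : Ω → β)
    (S T : Finset ι) :
    IcondMut p (tup X (S ∩ T)) Y (tup X (S ∩ T)ᶜ) +
        IcondMut p (tup X (S ∪ T)) Y (tup X (S ∪ T)ᶜ) ≤
      IcondMut p (tup X S) Y (tup X Sᶜ) + IcondMut p (tup X T) Y (tup X Tᶜ) := by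
  have h := Hent_tup_prodMk_submodular hp X Y Sᶜ Tᶜ
  have hm := hind.Hent_tup_modular hp Sᶜ Tᶜ
  simp only [IcondMut_tup_compl]
  rw [Finset.compl_inter, Finset.compl_union]
  linarith

end Tuples

theorem stmt16 {K : ℕ} (hK : 1 ≤ K) {Ω : Type} [Fintype Ω]
    {𝒳 : Fin (K + 1) → Type} [∀ k, Fintype (𝒳 k)] {𝒴 𝒵 : Type} [Fintype 𝒴] [Fintype 𝒵]
    (p : Ω → ℝ) (hp : IsPMF p)
    (X : ∀ k, Ω → 𝒳 k) (Y : Ω → 𝒴) (Z : Ω → 𝒵) (hind : MutIndep p X)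
    (S S₁ S' S₁' : Finset (Fin (K + 1)))
    (hS : S ⊆ Finset.univ.erase (Fin.last K)) (hSne : S.Nonempty)
    (hS₁ : S₁ ⊆ Finset.univ.erase (Fin.last K)) (hS₁ne : S₁.Nonempty)
    (hS' : S' ⊆ S) (hS'ne : S'.Nonempty) (hS₁' : S₁' ⊆ S₁) :
    (IcondMut p (tup X (S ∩ S₁)) Y
        (tup X (insert (Fin.last K) (Finset.univ.erase (Fin.last K) \ (S ∩ S₁)))) -
      Imut p (tup X (S' ∩ S₁')) Z) +
    (IcondMut p (tup X (insert (Fin.last K) (S ∪ S₁))) Y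
        (tup X (Finset.univ.erase (Fin.last K) \ (S ∪ S₁))) -
      Imut p (tup X (insert (Fin.last K) (S' ∪ S₁'))) Z) ≤
    (IcondMut p (tup X S) Y
        (tup X (insert (Fin.last K) (Finset.univ.erase (Fin.last K) \ S))) -
      Imut p (tup X (insert (Fin.last K) S')) Z) +
    (IcondMut p (tup X (insert (Fin.last K) S₁)) Y
        (tup X (Finset.univ.erase (Fin.last K) \ S₁)) -
      Imut p (tup X S₁') Z) := by
  have hlS : Fin.last K ∉ S := fun h => by simpa using hS h
  have hlS₁ : Fin.last K ∉ S₁ := fun h => by simpa using hS₁ h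
  have hY := hind.IcondMut_tup_submodular hp Y S (insert (Fin.last K) S₁)
  have hZ := hind.Imut_tup_supermodular hp Z (insert (Fin.last K) S') S₁'
  rw [Finset.inter_insert_of_notMem hlS, Finset.union_insert] at hY
  rw [Finset.insert_inter_of_notMem fun h => hlS₁ (hS₁' h), Finset.insert_union] at hZ
  have hcompl : ∀ T : Finset (Fin (K + 1)), Fin.last K ∉ T →
      insert (Fin.last K) (Finset.univ.erase (Fin.last K) \ T) = Tᶜ := by
    intro T hT
    ext k
    simp only [Finset.mem_insert, Finset.mem_sdiff, Finset.mem_erase, Finset.mem_univ,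
      Finset.mem_compl]
    grind
  have hcompl_insert : ∀ T : Finset (Fin (K + 1)),
      Finset.univ.erase (Fin.last K) \ T = (insert (Fin.last K) T)ᶜ := by
    intro T
    ext k
    simp
  rw [hcompl S hlS, hcompl (S ∩ S₁) fun h => hlS (Finset.mem_inter.1 h).1, hcompl_insert S₁,
    hcompl_insert (S ∪ S₁)]
  linarith
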